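/- arXiv:1307.0150 — 2 statements merged into one kernel-verified Lean document; each statement's English description precedes it below -/
import Mathlib

section
/- For all natural numbers x, y, z: the formula [((x = 0 ∨ y = 0) → z = 0) ∧ ((x ≠ 0 ∧ y ≠ 0) → (z / x = y ∧ (z - 1) / x < y))] holds if and only if z = x * y. (That is, the paper's Δ₀* predicate Mult(x,y,z) correctly defines multiplication as a 3-way relation.) -/
/-- The paper's Δ₀* predicate Mult(x,y,z) correctly defines multiplication
as a 3-way relation over ℕ (with truncated subtraction and floor division). -/
theorem mult_predicate_correct :
    ∀ x y z : ℕ,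
      ((((x = 0 ∨ y = 0) → z = 0) ∧
        ((x ≠ 0 ∧ y ≠ 0) → (z / x = y ∧ (z - 1) / x < y))) ↔ z = x * y) := by
  intro x y z
  rcases Nat.eq_zero_or_pos x with rfl | hx
  · simp
  rcases Nat.eq_zero_or_pos y with rfl | hy
  · simp
  have hxy : 0 < x * y := Nat.mul_pos hx hy
  have h : (z / x = y ∧ (z - 1) / x < y) ↔ z = x * y := by
    rw [Nat.div_lt_iff_lt_mul hx, Nat.mul_comm y x]
    constructor
    · rintro ⟨rfl, hlt⟩
      have := Nat.mul_div_le z x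
      omega
    · rintro rfl
      exact ⟨Nat.mul_div_cancel_left y hx, by omega⟩
  simpa [hx.ne', hy.ne'] using h
end

section
/- For all natural numbers x, y, z: the formula [((x = 0 ∨ y = 0) → z = 0) ∧ ((x ≠ 0 ∧ y ≠ 0) → (z / x = y ∧ (z - 1) / x < y))] holds if and only if the formula [((y = 0 ∨ x = 0) → z = 0) ∧ ((y ≠ 0 ∧ x ≠ 0) → (z / y = x ∧ (z - 1) / y < x))] holds. (That is, the commutative law of multiplication, expressed via the paper's 3-way predicate Mult, is valid: Mult(x,y,z) ↔ Mult(y,x,z).) -/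
/-- Division and truncated subtraction define the graph of multiplication. -/
theorem mult_predicate_iff_eq_mul (x y z : ℕ) :
    (((x = 0 ∨ y = 0) → z = 0) ∧
      ((x ≠ 0 ∧ y ≠ 0) → (z / x = y ∧ (z - 1) / x < y))) ↔ z = x * y := by
  rcases Nat.eq_zero_or_pos x with rfl | hx
  · simp
  rcases Nat.eq_zero_or_pos y with rfl | hy
  · simp
  have hxy : 0 < x * y := Nat.mul_pos hx hy
  simp only [hx.ne', hy.ne', or_self, false_imp_iff, ne_eq, not_false_eq_true, and_self,
    true_imp_iff, true_and, Nat.div_lt_iff_lt_mul hx, mul_comm y x]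
  constructor
  · rintro ⟨rfl, h⟩
    have := Nat.mul_div_le z x
    omega
  · rintro rfl
    exact ⟨Nat.mul_div_cancel_left y hx, by omega⟩

/-- The commutative law of multiplication, expressed via the paper's
3-way predicate Mult: Mult(x,y,z) ↔ Mult(y,x,z). -/
theorem mult_predicate_comm :
    ∀ x y z : ℕ,
      ((((x = 0 ∨ y = 0) → z = 0) ∧
        ((x ≠ 0 ∧ y ≠ 0) → (z / x = y ∧ (z - 1) / x < y))) ↔
       (((y = 0 ∨ x = 0) → z = 0) ∧
        ((y ≠ 0 ∧ x ≠ 0) → (z / y = x ∧ (z - 1) / y < x)))) := by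
  intro x y z
  rw [mult_predicate_iff_eq_mul, mult_predicate_iff_eq_mul, mul_comm]
end
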